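/- Let K ⊆ V* and K' ⊆ 𝕍 = V × V* be subspaces with K' ∩ V* = {0} and K + K' ⊆ Ann(K + K'), and set N' = a(K'). Then N' ⊆ Ann_V(K), the projection a induces a well-defined surjective linear map from 𝕍_K = Ann(K + K')/(K + K') onto W_K = Ann_V(K)/N', the kernel of this map is a maximal isotropic subspace of 𝕍_K with respect to the induced pairing (it equals its own orthogonal), and consequently dim 𝕍_K = 2·dim(Ann_V(K)/N'). (Self-dual exact sequence 0 → W_K* → 𝕍_K → W_K → 0 of Lemma courant:extend.) -/

import Mathlib

/-- The generalized tangent space `𝕍 = V × V*`. -/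
abbrev GV (V : Type*) [AddCommGroup V] [Module ℝ V] := V × Module.Dual ℝ V

variable (V : Type*) [AddCommGroup V] [Module ℝ V] [FiniteDimensional ℝ V]

/-- The canonical symmetric pairing `⟨(X,ξ),(Y,η)⟩ = (1/2)(η X + ξ Y)` on `𝕍`. -/
noncomputable def pairForm : LinearMap.BilinForm ℝ (GV V) :=
  LinearMap.mk₂ ℝ (fun u v => (1 / 2 : ℝ) * (v.2 u.1 + u.2 v.1))
    (fun u u' v => by simp; ring)
    (fun c u v => by simp; ring)
    (fun u v v' => by simp; ring)
    (fun c u v => by simp; ring)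

/-- `V* = {0} × V*` as a subspace of `𝕍`. -/
def VStar : Submodule ℝ (GV V) := LinearMap.range (LinearMap.inr ℝ V (Module.Dual ℝ V))

variable {V}

/-- The annihilator of a subspace of `𝕍` with respect to the canonical pairing. -/
noncomputable def Ann (S : Submodule ℝ (GV V)) : Submodule ℝ (GV V) where
  carrier := {u : GV V | ∀ s ∈ S, pairForm V u s = 0}
  add_mem' := fun ha hb s hs => by simp [ha s hs, hb s hs]
  zero_mem' := fun s hs => by simp
  smul_mem' := fun c a ha s hs => by simp [ha s hs]

/-- The image in `𝕍` of a subspace `K ⊆ V*`. -/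
def ofDual (K : Submodule ℝ (Module.Dual ℝ V)) : Submodule ℝ (GV V) :=
  K.map (LinearMap.inr ℝ V (Module.Dual ℝ V))

/-- A linear generalized complex structure on `𝕍`. -/
structure IsGenCx (J : GV V →ₗ[ℝ] GV V) : Prop where
  sq : ∀ u, J (J u) = -u
  orth : ∀ u v, pairForm V (J u) (J v) = pairForm V u v

/-- A linear generalized Kähler structure on `𝕍`: two commuting linear generalized
complex structures such that `G = -J₁∘J₂` gives a positive definite form `⟨G·,·⟩`. -/
structure IsGenKahler (J₁ J₂ : GV V →ₗ[ℝ] GV V) : Prop where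
  cx1 : IsGenCx J₁
  cx2 : IsGenCx J₂
  comm : ∀ u, J₁ (J₂ u) = J₂ (J₁ u)
  posdef : ∀ u : GV V, u ≠ 0 → 0 < pairForm V (-(J₁ (J₂ u))) u

lemma pairForm_apply' {V : Type*} [AddCommGroup V] [Module ℝ V] (u v : GV V) :
    pairForm V u v = (1 / 2 : ℝ) * (v.2 u.1 + u.2 v.1) := rfl

lemma pairForm_comm {V : Type*} [AddCommGroup V] [Module ℝ V] (u v : GV V) :
    pairForm V u v = pairForm V v u := by
  rw [pairForm_apply', pairForm_apply', add_comm]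

lemma pairForm_nondegenerate {V : Type*} [AddCommGroup V] [Module ℝ V] :
    (pairForm V).Nondegenerate := by
  have key : ∀ u : GV V, (∀ v, pairForm V u v = 0) → u = 0 := by
    intro u hu
    refine Prod.ext ?_ ?_
    · refine (Module.forall_dual_apply_eq_zero_iff ℝ u.1).1 fun f => ?_
      have h := hu (0, f)
      simpa [pairForm_apply'] using h
    · refine LinearMap.ext fun x => ?_
      have h := hu (x, 0)
      simpa [pairForm_apply'] using h
  exact ⟨key, fun u hu => key u fun v => by rw [pairForm_comm]; exact hu v⟩

lemma Ann_eq_orthogonal {V : Type*} [AddCommGroup V] [Module ℝ V] (S : Submodule ℝ (GV V)) :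
    Ann S = (pairForm V).orthogonal S := by
  ext u
  rw [LinearMap.BilinForm.mem_orthogonal_iff]
  exact forall₂_congr fun s _ => by
    rw [pairForm_comm]

lemma finrank_Ann_add {V : Type*} [AddCommGroup V] [Module ℝ V] [FiniteDimensional ℝ V]
    (S : Submodule ℝ (GV V)) :
    Module.finrank ℝ (Ann S) + Module.finrank ℝ S = 2 * Module.finrank ℝ V := by
  have h := LinearMap.BilinForm.finrank_orthogonal pairForm_nondegenerate S
  have hS := S.finrank_le
  rw [Module.finrank_prod, Subspace.dual_finrank_eq] at h hS
  rw [Ann_eq_orthogonal]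
  omega

lemma mem_Ann_sup_iff {V : Type*} [AddCommGroup V] [Module ℝ V]
    {K : Submodule ℝ (Module.Dual ℝ V)} {K' : Submodule ℝ (GV V)} {u : GV V} :
    u ∈ Ann (ofDual K ⊔ K') ↔
      u.1 ∈ K.dualCoannihilator ∧ ∀ s ∈ K', s.2 u.1 + u.2 s.1 = 0 := by
  constructor
  · intro hu
    refine ⟨(Submodule.mem_dualCoannihilator _).2 fun k hk => ?_, fun s hs => ?_⟩
    · have h := hu (0, k) (Submodule.mem_sup_left ⟨k, hk, rfl⟩)
      simpa [pairForm_apply'] using h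
    · have h := hu s (Submodule.mem_sup_right hs)
      simpa [pairForm_apply'] using h
  · rintro ⟨h₁, h₂⟩ s hs
    obtain ⟨_, ⟨k, hk, rfl⟩, t, ht, rfl⟩ := Submodule.mem_sup.1 hs
    have hk0 := (Submodule.mem_dualCoannihilator _).1 h₁ k hk
    rw [map_add, pairForm_apply', pairForm_apply', h₂ t ht]
    simp [hk0]

set_option maxSynthPendingDepth 3 in
lemma injective_fst_domRestrict {V : Type*} [AddCommGroup V] [Module ℝ V]
    {K' : Submodule ℝ (GV V)} (hKV : K' ⊓ VStar V = ⊥) :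
    Function.Injective ((LinearMap.fst ℝ V (Module.Dual ℝ V)).domRestrict K') := by
  rw [← LinearMap.ker_eq_bot, LinearMap.ker_eq_bot']
  rintro ⟨⟨X, ξ⟩, hu⟩ (h : X = 0)
  subst h
  have h0 : ((0, ξ) : GV V) ∈ K' ⊓ VStar V := ⟨hu, ξ, rfl⟩
  rw [hKV, Submodule.mem_bot] at h0
  exact Subtype.ext h0

set_option maxSynthPendingDepth 3 in
/-- Over a subspace `K'` meeting `V*` trivially, every vector `X` has a covector `η` for which
`(X, η)` is orthogonal to `K'`. -/
lemma exists_dual_orthogonal {V : Type*} [AddCommGroup V] [Module ℝ V]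
    {K' : Submodule ℝ (GV V)} (hKV : K' ⊓ VStar V = ⊥) (X : V) :
    ∃ η : Module.Dual ℝ V, ∀ s ∈ K', s.2 X + η s.1 = 0 := by
  obtain ⟨g, hg⟩ := LinearMap.exists_leftInverse_of_injective _
    (LinearMap.ker_eq_bot.2 (injective_fst_domRestrict hKV))
  refine ⟨-(Module.Dual.eval ℝ V X ∘ₗ LinearMap.snd ℝ V (Module.Dual ℝ V) ∘ₗ K'.subtype ∘ₗ g),
    fun s hs => ?_⟩
  have h : g s.1 = ⟨s, hs⟩ := LinearMap.congr_fun hg ⟨s, hs⟩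
  simp [h]

set_option maxSynthPendingDepth 3 in
lemma finrank_ofDual_sup {V : Type*} [AddCommGroup V] [Module ℝ V] [FiniteDimensional ℝ V]
    (K : Submodule ℝ (Module.Dual ℝ V)) {K' : Submodule ℝ (GV V)} (hKV : K' ⊓ VStar V = ⊥) :
    Module.finrank ℝ ↥(ofDual K ⊔ K') = Module.finrank ℝ K +
      Module.finrank ℝ (K'.map (LinearMap.fst ℝ V (Module.Dual ℝ V))) := by
  have h₁ : Module.finrank ℝ (ofDual K) = Module.finrank ℝ K :=
    (K.equivMapOfInjective _ LinearMap.inr_injective).finrank_eq.symm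
  have h₂ : Module.finrank ℝ (K'.map (LinearMap.fst ℝ V (Module.Dual ℝ V))) =
      Module.finrank ℝ K' := by
    rw [← LinearMap.range_domRestrict]
    exact LinearMap.finrank_range_of_inj (injective_fst_domRestrict hKV)
  have h₃ : ofDual K ⊓ K' = ⊥ := by
    rw [eq_bot_iff, ← hKV]
    exact fun u hu => ⟨hu.2, LinearMap.map_le_range hu.1⟩
  have h := Submodule.finrank_sup_add_finrank_inf_eq (ofDual K) K'
  rw [h₃, finrank_bot] at h
  omega

set_option maxSynthPendingDepth 3 in
/-- self-dual exact sequence `0 → W_K* → 𝕍_K → W_K → 0` of Lemma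
courant:extend: with `N' = a(K')`, one has `N' ⊆ Ann_V(K)`; the projection `a`
induces a well-defined surjection `𝕍_K = Ann(K+K')/(K+K') → W_K = Ann_V(K)/N'`;
its kernel is maximal isotropic (equal to its own orthogonal); and
`dim 𝕍_K = 2 dim(Ann_V(K)/N')`. -/
theorem statement11 {V : Type*} [AddCommGroup V] [Module ℝ V] [FiniteDimensional ℝ V]
    (K : Submodule ℝ (Module.Dual ℝ V)) (K' : Submodule ℝ (GV V))
    (hKV : K' ⊓ VStar V = ⊥)
    (hIso : ofDual K ⊔ K' ≤ Ann (ofDual K ⊔ K')) :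
    let A : Submodule ℝ (GV V) := Ann (ofDual K ⊔ K')
    let N' : Submodule ℝ V := K'.map (LinearMap.fst ℝ V (Module.Dual ℝ V))
    N' ≤ K.dualCoannihilator ∧
    (∀ x ∈ A, (x : GV V).1 ∈ K.dualCoannihilator) ∧
    (∀ x ∈ A, ∀ y ∈ A, x - y ∈ ofDual K ⊔ K' → (x : GV V).1 - (y : GV V).1 ∈ N') ∧
    (∀ X ∈ K.dualCoannihilator, ∃ w ∈ A, (w : GV V).1 - X ∈ N') ∧
    (∀ x ∈ A, ∀ y ∈ A, (x : GV V).1 ∈ N' → (y : GV V).1 ∈ N' → pairForm V x y = 0) ∧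
    (∀ x ∈ A, (∀ y ∈ A, (y : GV V).1 ∈ N' → pairForm V x y = 0) → (x : GV V).1 ∈ N') ∧
    Module.finrank ℝ ((↥A) ⧸ ((ofDual K ⊔ K').comap A.subtype)) + 2 * Module.finrank ℝ N'
      = 2 * Module.finrank ℝ K.dualCoannihilator := by
  intro A N'
  have hN' : ∀ s ∈ K', s.1 ∈ N' := fun s hs => Submodule.mem_map_of_mem hs
  have hK'A : K' ≤ A := le_sup_right.trans hIso
  refine ⟨?_, fun x hx => (mem_Ann_sup_iff.1 hx).1, ?_, ?_, ?_, ?_, ?_⟩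
  · rintro _ ⟨s, hs, rfl⟩
    exact (mem_Ann_sup_iff.1 (hK'A hs)).1
  · intro x _ y _ hxy
    obtain ⟨_, ⟨k, _, rfl⟩, t, ht, h⟩ := Submodule.mem_sup.1 hxy
    have h1 : t.1 = x.1 - y.1 := by simpa using congrArg Prod.fst h
    exact h1 ▸ hN' t ht
  · intro X hX
    obtain ⟨η, hη⟩ := exists_dual_orthogonal hKV X
    exact ⟨(X, η), mem_Ann_sup_iff.2 ⟨hX, hη⟩, by simp⟩
  · rintro x hx y hy ⟨s, hs, hsx⟩ ⟨t, ht, hty⟩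
    replace hsx : s.1 = x.1 := hsx
    replace hty : t.1 = y.1 := hty
    have h₁ := (mem_Ann_sup_iff.1 hx).2 t ht
    have h₂ := (mem_Ann_sup_iff.1 hy).2 s hs
    have h₃ := (mem_Ann_sup_iff.1 (hK'A hs)).2 t ht
    rw [hsx] at h₂ h₃
    rw [hty] at h₁ h₃
    rw [pairForm_apply']
    linarith
  · intro x _ hxy
    rw [← Subspace.forall_mem_dualAnnihilator_apply_eq_zero_iff]
    intro η hη
    have hηN := (Submodule.mem_dualAnnihilator η).1 hη
    have h := hxy (0, η)
      (mem_Ann_sup_iff.2 ⟨Submodule.zero_mem _, fun s hs => by simp [hηN s.1 (hN' s hs)]⟩)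
      (Submodule.zero_mem _)
    simpa [pairForm_apply'] using h
  · have h₁ := Submodule.finrank_quotient_add_finrank ((ofDual K ⊔ K').comap A.subtype)
    have h₂ : Module.finrank ℝ ((ofDual K ⊔ K').comap A.subtype) = _ :=
      (Submodule.comapSubtypeEquivOfLe hIso).finrank_eq
    have h₃ : Module.finrank ℝ A + _ = _ := finrank_Ann_add (ofDual K ⊔ K')
    have h₄ : _ = _ + Module.finrank ℝ N' := finrank_ofDual_sup K hKV
    have h₅ := Subspace.finrank_add_finrank_dualCoannihilator_eq K
    omega
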